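/- The system EN^{∇•} is sound and strongly complete with respect to the class of (n)-frames: for every set Γ ∪ {φ} of L(∇,•)-formulas, Γ ⊢_{EN^{∇•}} φ if and only if every pointed model (M,s) with M an (n)-model satisfying all members of Γ also satisfies φ. -/

import Mathlib

/-- The language L(∇,•) over propositional variables indexed by ℕ. -/
inductive Formula : Type
  | atom : ℕ → Formula
  | neg : Formula → Formula
  | and : Formula → Formula → Formula
  | nabla : Formula → Formula
  | bullet : Formula → Formula

namespace Formula

/-- Disjunction, defined from ¬ and ∧ as usual. -/
def or (φ ψ : Formula) : Formula := neg ((neg φ).and (neg ψ))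

/-- Implication, defined from ¬ and ∧ as usual. -/
def imp (φ ψ : Formula) : Formula := (neg φ).or ψ

/-- Biimplication, defined from ¬ and ∧ as usual. -/
def biimp (φ ψ : Formula) : Formula := (φ.imp ψ).and (ψ.imp φ)

/-- A fixed tautology ⊤. -/
def top : Formula := (atom 0).imp (atom 0)

/-- Δφ := ¬∇φ. -/
def delta (φ : Formula) : Formula := neg (nabla φ)

/-- ∘φ := ¬•φ. -/
def circ (φ : Formula) : Formula := neg (bullet φ)

end Formula

/-- A neighborhood model. -/
structure NbhdModel : Type 1 where
  S : Type
  ne : Nonempty S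
  N : S → Set (Set S)
  V : ℕ → Set S

namespace NbhdModel

/-- The truth set ⟦φ⟧_M of a formula in a neighborhood model. -/
def truthSet (M : NbhdModel) : Formula → Set M.S
  | .atom p => M.V p
  | .neg φ => (M.truthSet φ)ᶜ
  | .and φ ψ => M.truthSet φ ∩ M.truthSet ψ
  | .nabla φ => {s | M.truthSet φ ∉ M.N s ∧ (M.truthSet φ)ᶜ ∉ M.N s}
  | .bullet φ => {s | s ∈ M.truthSet φ ∧ M.truthSet φ ∉ M.N s}

/-- M,s ⊨ φ. -/
def Sat (M : NbhdModel) (s : M.S) (φ : Formula) : Prop := s ∈ M.truthSet φ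

/-- Property (n): N(s) contains the unit. -/
def PropN (M : NbhdModel) : Prop := ∀ s : M.S, (Set.univ : Set M.S) ∈ M.N s

/-- Property (r): N(s) contains its core. -/
def PropR (M : NbhdModel) : Prop := ∀ s : M.S, ⋂₀ (M.N s) ∈ M.N s

/-- Property (i): N(s) is closed under binary intersections. -/
def PropI (M : NbhdModel) : Prop :=
  ∀ (s : M.S) (X Y : Set M.S), X ∈ M.N s → Y ∈ M.N s → X ∩ Y ∈ M.N s

/-- Property (s): N(s) is supplemented (closed under supersets). -/
def PropS (M : NbhdModel) : Prop :=
  ∀ (s : M.S) (X Y : Set M.S), X ∈ M.N s → X ⊆ Y → Y ∈ M.N s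

/-- Property (c): N(s) is closed under complements. -/
def PropC (M : NbhdModel) : Prop :=
  ∀ (s : M.S) (X : Set M.S), X ∈ M.N s → Xᶜ ∈ M.N s

/-- Property (d). -/
def PropD (M : NbhdModel) : Prop :=
  ∀ (s : M.S) (X : Set M.S), X ∈ M.N s → Xᶜ ∉ M.N s

/-- Property (t). -/
def PropT (M : NbhdModel) : Prop :=
  ∀ (s : M.S) (X : Set M.S), X ∈ M.N s → s ∈ X

/-- Property (b). -/
def PropB (M : NbhdModel) : Prop :=
  ∀ (s : M.S) (X : Set M.S), s ∈ X → {u : M.S | Xᶜ ∉ M.N u} ∈ M.N s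

/-- Property (4). -/
def Prop4 (M : NbhdModel) : Prop :=
  ∀ (s : M.S) (X : Set M.S), X ∈ M.N s → {u : M.S | X ∈ M.N u} ∈ M.N s

/-- Property (5). -/
def Prop5 (M : NbhdModel) : Prop :=
  ∀ (s : M.S) (X : Set M.S), X ∉ M.N s → {u : M.S | X ∉ M.N u} ∈ M.N s

end NbhdModel

/-- φ is an instance of a propositional tautology (treating ∇ψ and •ψ subformulas
as atoms): every Boolean valuation that respects ¬ and ∧ makes φ true. -/
def IsTautology (φ : Formula) : Prop :=
  ∀ v : Formula → Bool,
    (∀ ψ : Formula, v ψ.neg = !v ψ) →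
    (∀ ψ χ : Formula, v (ψ.and χ) = (v ψ && v χ)) →
    v φ = true

/-- Theorems of the system E^{∇•} extended with the extra axioms in `Ax`:
all tautology instances, E1, E2, E3, the members of `Ax`, closed under
modus ponens, RE∇ and RE•. -/
inductive Prf (Ax : Set Formula) : Formula → Prop
  | taut {φ : Formula} : IsTautology φ → Prf Ax φ
  | e1 (φ : Formula) : Prf Ax ((Formula.nabla φ).biimp (Formula.nabla φ.neg))
  | e2 (φ : Formula) : Prf Ax ((Formula.bullet φ).imp φ)
  | e3 (φ : Formula) :
      Prf Ax ((Formula.nabla φ).imp ((Formula.bullet φ).or (Formula.bullet φ.neg)))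
  | ax {φ : Formula} : φ ∈ Ax → Prf Ax φ
  | mp {φ ψ : Formula} : Prf Ax (φ.imp ψ) → Prf Ax φ → Prf Ax ψ
  | reN {φ ψ : Formula} :
      Prf Ax (φ.biimp ψ) → Prf Ax ((Formula.nabla φ).biimp (Formula.nabla ψ))
  | reB {φ ψ : Formula} :
      Prf Ax (φ.biimp ψ) → Prf Ax ((Formula.bullet φ).biimp (Formula.bullet ψ))

/-- Γ ⊢_Λ φ: derivable from theorems of the system together with members of Γ
by modus ponens. -/
inductive Deriv (Ax : Set Formula) (Γ : Set Formula) : Formula → Prop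
  | thm {φ : Formula} : Prf Ax φ → Deriv Ax Γ φ
  | prem {φ : Formula} : φ ∈ Γ → Deriv Ax Γ φ
  | mp {φ ψ : Formula} : Deriv Ax Γ (φ.imp ψ) → Deriv Ax Γ φ → Deriv Ax Γ ψ

/-- No extra axioms: the system E^{∇•}. -/
def EAx : Set Formula := ∅

/-- Extra axiom E4: •φ → ∇φ (all instances); E^{∇•} plus these is E_c^{∇•}. -/
def EcAx : Set Formula := {α | ∃ φ : Formula, α = (Formula.bullet φ).imp (Formula.nabla φ)}

/-- Extra axiom ∘⊤; E^{∇•} plus this is EN^{∇•}. -/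
def ENAx : Set Formula := {Formula.top.bullet.neg}

/-- Extra axioms M1–M4 (all instances); E^{∇•} plus these is M^{∇•}. -/
def MAx : Set Formula :=
  {α | ∃ φ ψ χ : Formula,
      α = ((Formula.nabla (φ.or ψ)).and (Formula.nabla (φ.neg.or χ))).imp (Formula.nabla φ)} ∪
  {α | ∃ φ ψ χ : Formula,
      α = ((Formula.bullet (φ.or ψ)).and (Formula.bullet (φ.neg.or χ))).imp (Formula.nabla φ)} ∪
  {α | ∃ φ ψ χ : Formula,
      α = ((Formula.bullet (φ.or ψ)).and (Formula.nabla (φ.neg.or χ))).imp (Formula.nabla φ)} ∪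
  {α | ∃ φ ψ : Formula,
      α = (φ.circ.and φ).imp ((Formula.delta (φ.or ψ)).and (Formula.circ (φ.or ψ)))}

/-- Extra axioms of R^{∇•}: those of M^{∇•} plus R1 and R2 (all instances). -/
def RAx : Set Formula :=
  MAx ∪
  {α | ∃ φ ψ : Formula,
      α = ((Formula.delta φ).and (Formula.delta ψ)).imp (Formula.delta (φ.and ψ))} ∪
  {α | ∃ φ ψ : Formula,
      α = ((Formula.circ φ).and (Formula.circ ψ)).imp (Formula.circ (φ.and ψ))}

/-- Extra axioms of K^{∇•}: those of R^{∇•} plus ∘⊤. -/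
def KAx : Set Formula := RAx ∪ {Formula.top.bullet.neg}

open Formula

namespace NbhdModel

variable (M : NbhdModel) (s : M.S) (φ ψ : Formula)

theorem sat_neg : M.Sat s φ.neg ↔ ¬ M.Sat s φ := Iff.rfl

theorem sat_and : M.Sat s (φ.and ψ) ↔ M.Sat s φ ∧ M.Sat s ψ := Iff.rfl

theorem sat_nabla :
    M.Sat s φ.nabla ↔ M.truthSet φ ∉ M.N s ∧ (M.truthSet φ)ᶜ ∉ M.N s := Iff.rfl

theorem sat_bullet : M.Sat s φ.bullet ↔ M.Sat s φ ∧ M.truthSet φ ∉ M.N s := Iff.rfl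

theorem sat_or : M.Sat s (φ.or ψ) ↔ M.Sat s φ ∨ M.Sat s ψ := by
  simp only [Formula.or, sat_neg, sat_and]; tauto

theorem sat_imp : M.Sat s (φ.imp ψ) ↔ (M.Sat s φ → M.Sat s ψ) := by
  simp only [Formula.imp, sat_or, sat_neg]; tauto

theorem sat_biimp : M.Sat s (φ.biimp ψ) ↔ (M.Sat s φ ↔ M.Sat s ψ) := by
  simp only [Formula.biimp, sat_and, sat_imp]; tauto

variable {M φ ψ}

theorem truthSet_eq_of_sat_biimp (h : ∀ s, M.Sat s (φ.biimp ψ)) :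
    M.truthSet φ = M.truthSet ψ :=
  Set.ext fun s => (sat_biimp M s φ ψ).1 (h s)

open Classical in
theorem sat_of_isTautology (h : IsTautology φ) (s : M.S) : M.Sat s φ := by
  have := h (fun ψ => decide (M.Sat s ψ)) (by simp [sat_neg]) (by simp [sat_and])
  simpa using this

theorem sat_of_prf {Ax : Set Formula} (hAx : ∀ α ∈ Ax, ∀ s, M.Sat s α) (h : Prf Ax φ) :
    ∀ s, M.Sat s φ := by
  induction h with
  | taut h => exact sat_of_isTautology h
  | e1 φ =>
    intro s
    simp only [sat_biimp, sat_nabla, truthSet, compl_compl]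
    tauto
  | e2 φ =>
    intro s
    simp only [sat_imp, sat_bullet]
    tauto
  | e3 φ =>
    intro s
    simp only [sat_imp, sat_or, sat_bullet, sat_nabla, sat_neg, truthSet]
    tauto
  | ax h => exact hAx _ h
  | mp _ _ ih₁ ih₂ => exact fun s => (sat_imp M s _ _).1 (ih₁ s) (ih₂ s)
  | reN _ ih =>
    intro s
    simp only [sat_biimp, sat_nabla, truthSet_eq_of_sat_biimp ih]
  | reB _ ih =>
    intro s
    simp only [sat_biimp, sat_bullet]
    simp only [Sat, truthSet_eq_of_sat_biimp ih]

theorem sat_of_deriv {Ax Γ : Set Formula} (hAx : ∀ α ∈ Ax, ∀ s, M.Sat s α)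
    (h : Deriv Ax Γ φ) {s : M.S} (hs : ∀ γ ∈ Γ, M.Sat s γ) : M.Sat s φ := by
  induction h with
  | thm h => exact sat_of_prf hAx h s
  | prem h => exact hs _ h
  | mp _ _ ih₁ ih₂ => exact (sat_imp M s _ _).1 ih₁ ih₂

theorem sat_top (s : M.S) : M.Sat s top := (sat_imp M s _ _).2 id

theorem PropN.sat_ENAx (hM : M.PropN) : ∀ α ∈ ENAx, ∀ s, M.Sat s α := by
  rintro α rfl s
  have h : M.truthSet top = Set.univ := Set.eq_univ_of_forall sat_top
  simp [sat_neg, sat_bullet, h, hM s]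

end NbhdModel

namespace Deriv

variable {Ax Γ Γ' : Set Formula} {φ ψ χ : Formula}

theorem mono (hΓ : Γ ⊆ Γ') (h : Deriv Ax Γ φ) : Deriv Ax Γ' φ := by
  induction h with
  | thm h => exact thm h
  | prem h => exact prem (hΓ h)
  | mp _ _ ih₁ ih₂ => exact mp ih₁ ih₂

theorem prf_of_empty (h : Deriv Ax ∅ φ) : Prf Ax φ := by
  induction h with
  | thm h => exact h
  | prem h => exact h.elim
  | mp _ _ ih₁ ih₂ => exact Prf.mp ih₁ ih₂

theorem of_taut_imp (h : IsTautology (φ.imp ψ)) (hφ : Deriv Ax Γ φ) : Deriv Ax Γ ψ :=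
  mp (thm (.taut h)) hφ

theorem of_taut_imp₂ (h : IsTautology (φ.imp (ψ.imp χ))) (hφ : Deriv Ax Γ φ)
    (hψ : Deriv Ax Γ ψ) : Deriv Ax Γ χ :=
  mp (of_taut_imp h hφ) hψ

theorem deduction (h : Deriv Ax (insert ψ Γ) φ) : Deriv Ax Γ (ψ.imp φ) := by
  have weaken {φ : Formula} (h : Deriv Ax Γ φ) : Deriv Ax Γ (ψ.imp φ) :=
    h.of_taut_imp fun v hn ha => by simp only [Formula.imp, Formula.or, hn, ha]; grind
  induction h with
  | thm h => exact weaken (thm h)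
  | prem h =>
    rcases h with rfl | h
    · exact thm (.taut fun v hn ha => by simp [Formula.imp, Formula.or, hn, ha])
    · exact weaken (prem h)
  | mp _ _ ih₁ ih₂ =>
    exact of_taut_imp₂
      (fun v hn ha => by simp only [Formula.imp, Formula.or, hn, ha]; grind) ih₁ ih₂

theorem exists_mem_of_sUnion {c : Set (Set Formula)} (hc : IsChain (· ⊆ ·) c)
    (hne : c.Nonempty) (h : Deriv Ax (⋃₀ c) φ) : ∃ T ∈ c, Deriv Ax T φ := by
  induction h with
  | thm h => exact hne.imp fun T hT => ⟨hT, thm h⟩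
  | prem h => exact let ⟨T, hT, hφ⟩ := h; ⟨T, hT, prem hφ⟩
  | mp _ _ ih₁ ih₂ =>
    obtain ⟨T₁, hT₁, h₁⟩ := ih₁
    obtain ⟨T₂, hT₂, h₂⟩ := ih₂
    rcases hc.total hT₁ hT₂ with h | h
    · exact ⟨T₂, hT₂, mp (h₁.mono h) h₂⟩
    · exact ⟨T₁, hT₁, mp h₁ (h₂.mono h)⟩

end Deriv

/-- Maximal consistent sets, described as the deductively closed sets that contain exactly one
of `φ` and `¬φ` for each formula `φ`. -/
structure IsMaxConsistent (Ax T : Set Formula) : Prop where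
  closed : ∀ {φ : Formula}, Deriv Ax T φ → φ ∈ T
  neg_mem_iff : ∀ {φ : Formula}, φ.neg ∈ T ↔ φ ∉ T

namespace IsMaxConsistent

variable {Ax T : Set Formula} {φ ψ : Formula}

theorem mem_of_prf (hT : IsMaxConsistent Ax T) (h : Prf Ax φ) : φ ∈ T :=
  hT.closed (.thm h)

theorem and_mem_iff (hT : IsMaxConsistent Ax T) : φ.and ψ ∈ T ↔ φ ∈ T ∧ ψ ∈ T := by
  refine ⟨fun h => ⟨?_, ?_⟩, fun h => ?_⟩
  · exact hT.closed <| Deriv.of_taut_imp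
      (fun v hn ha => by simp only [Formula.imp, Formula.or, hn, ha]; grind) (.prem h)
  · exact hT.closed <| Deriv.of_taut_imp
      (fun v hn ha => by simp only [Formula.imp, Formula.or, hn, ha]; grind) (.prem h)
  · exact hT.closed <| Deriv.of_taut_imp₂
      (fun v hn ha => by simp only [Formula.imp, Formula.or, hn, ha]; grind)
      (.prem h.1) (.prem h.2)

theorem or_mem_iff (hT : IsMaxConsistent Ax T) : φ.or ψ ∈ T ↔ φ ∈ T ∨ ψ ∈ T := by
  simp only [Formula.or, hT.neg_mem_iff, hT.and_mem_iff]; tauto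

theorem imp_mem_iff (hT : IsMaxConsistent Ax T) : φ.imp ψ ∈ T ↔ (φ ∈ T → ψ ∈ T) := by
  simp only [Formula.imp, hT.or_mem_iff, hT.neg_mem_iff]; tauto

theorem biimp_mem_iff (hT : IsMaxConsistent Ax T) : φ.biimp ψ ∈ T ↔ (φ ∈ T ↔ ψ ∈ T) := by
  simp only [Formula.biimp, hT.and_mem_iff, hT.imp_mem_iff]; tauto

theorem nabla_neg_mem_iff (hT : IsMaxConsistent Ax T) : φ.neg.nabla ∈ T ↔ φ.nabla ∈ T :=
  (hT.biimp_mem_iff.1 (hT.mem_of_prf (.e1 φ))).symm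

theorem mem_of_bullet_mem (hT : IsMaxConsistent Ax T) (h : φ.bullet ∈ T) : φ ∈ T :=
  hT.imp_mem_iff.1 (hT.mem_of_prf (.e2 φ)) h

theorem bullet_mem_of_nabla_mem (hT : IsMaxConsistent Ax T) (h : φ.nabla ∈ T) (hφ : φ ∈ T) :
    φ.bullet ∈ T :=
  (hT.or_mem_iff.1 (hT.imp_mem_iff.1 (hT.mem_of_prf (.e3 φ)) h)).resolve_right
    fun h' => hT.neg_mem_iff.1 (hT.mem_of_bullet_mem h') hφ

end IsMaxConsistent

/-- Lindenbaum's lemma. -/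
theorem exists_isMaxConsistent_of_not_deriv {Ax Γ : Set Formula} {φ : Formula}
    (h : ¬ Deriv Ax Γ φ) : ∃ T, IsMaxConsistent Ax T ∧ Γ ⊆ T ∧ φ ∉ T := by
  obtain ⟨T, hΓT, hT⟩ := zorn_subset_nonempty {T | ¬ Deriv Ax T φ}
    (fun c hcS hc hne => ⟨⋃₀ c, fun hd =>
      let ⟨T, hTc, hTφ⟩ := hd.exists_mem_of_sUnion hc hne
      hcS hTc hTφ, fun _ => Set.subset_sUnion_of_mem⟩) Γ h
  have himp {ψ : Formula} (hψ : ψ ∉ T) : Deriv Ax T (ψ.imp φ) :=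
    Deriv.deduction <| by_contra fun hd =>
      hψ (hT.le_of_ge (y := insert ψ T) hd (Set.subset_insert ψ T) (Set.mem_insert ψ T))
  refine ⟨T, ⟨fun {ψ} hψ => ?_, fun {ψ} => ⟨fun hn hψ => ?_, fun hψ => ?_⟩⟩, hΓT,
    fun hφ => hT.prop (.prem hφ)⟩
  · exact by_contra fun hmem => hT.prop (.mp (himp hmem) hψ)
  · exact hT.prop <| Deriv.of_taut_imp₂
      (fun v hn ha => by simp only [Formula.imp, Formula.or, hn, ha]; grind)
      (.prem hn) (.prem hψ)
  · exact by_contra fun hn => hT.prop <| Deriv.of_taut_imp₂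
      (fun v hn ha => by simp only [Formula.imp, Formula.or, hn, ha]; grind)
      (himp hψ) (himp hn)

/-- The set of maximal consistent sets containing a given formula. -/
def proofSet (Ax : Set Formula) (φ : Formula) : Set {T // IsMaxConsistent Ax T} :=
  {T | φ ∈ T.1}

section

variable {Ax : Set Formula} {φ ψ : Formula}

theorem proofSet_neg : proofSet Ax φ.neg = (proofSet Ax φ)ᶜ :=
  Set.ext fun T => T.2.neg_mem_iff

theorem prf_biimp_of_proofSet_eq (h : proofSet Ax φ = proofSet Ax ψ) :
    Prf Ax (φ.biimp ψ) := by
  by_contra hd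
  obtain ⟨T, hT, -, hmem⟩ := exists_isMaxConsistent_of_not_deriv fun h' => hd h'.prf_of_empty
  exact hmem (hT.biimp_mem_iff.2 (Set.ext_iff.1 h ⟨T, hT⟩))

/-- The canonical neighborhoods of a maximal consistent set: the proof sets of the formulas
that are neither contingent nor accidental there. -/
def canonicalNbhds (T : {T // IsMaxConsistent Ax T}) : Set (Set {T // IsMaxConsistent Ax T}) :=
  {X | ∃ φ : Formula, X = proofSet Ax φ ∧ φ.nabla ∉ T.1 ∧ φ.bullet ∉ T.1}

theorem proofSet_mem_canonicalNbhds {T : {T // IsMaxConsistent Ax T}} :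
    proofSet Ax φ ∈ canonicalNbhds T ↔ φ.nabla ∉ T.1 ∧ φ.bullet ∉ T.1 := by
  refine ⟨fun ⟨ψ, h, hN, hB⟩ => ?_, fun h => ⟨φ, rfl, h⟩⟩
  have hprf := prf_biimp_of_proofSet_eq h
  exact ⟨fun h' => hN ((T.2.biimp_mem_iff.1 (T.2.mem_of_prf hprf.reN)).1 h'),
    fun h' => hB ((T.2.biimp_mem_iff.1 (T.2.mem_of_prf hprf.reB)).1 h')⟩

/-- The canonical model, on a nonempty set of states. -/
def canonicalModel (Ax : Set Formula) (hne : Nonempty {T // IsMaxConsistent Ax T}) :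
    NbhdModel where
  S := {T // IsMaxConsistent Ax T}
  ne := hne
  N := canonicalNbhds
  V p := proofSet Ax (atom p)

theorem truthSet_canonicalModel (hne : Nonempty {T // IsMaxConsistent Ax T}) (φ : Formula) :
    (canonicalModel Ax hne).truthSet φ = proofSet Ax φ := by
  induction φ with
  | atom p => rfl
  | neg φ ih => rw [proofSet_neg, ← ih]; rfl
  | and φ ψ ihφ ihψ =>
    rw [NbhdModel.truthSet, ihφ, ihψ]
    exact Set.ext fun T => T.2.and_mem_iff.symm
  | nabla φ ih =>
    rw [NbhdModel.truthSet, ih]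
    refine Set.ext fun (T : {T // IsMaxConsistent Ax T}) => ?_
    change (proofSet Ax φ ∉ canonicalNbhds T ∧ (proofSet Ax φ)ᶜ ∉ canonicalNbhds T) ↔
      φ.nabla ∈ T.1
    rw [← proofSet_neg, proofSet_mem_canonicalNbhds, proofSet_mem_canonicalNbhds,
      T.2.nabla_neg_mem_iff]
    have hφ := T.2.mem_of_bullet_mem (φ := φ)
    have hnφ := T.2.mem_of_bullet_mem (φ := φ.neg)
    rw [T.2.neg_mem_iff] at hnφ
    tauto
  | bullet φ ih =>
    rw [NbhdModel.truthSet, ih]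
    refine Set.ext fun (T : {T // IsMaxConsistent Ax T}) => ?_
    change (φ ∈ T.1 ∧ proofSet Ax φ ∉ canonicalNbhds T) ↔ φ.bullet ∈ T.1
    rw [proofSet_mem_canonicalNbhds]
    have hB := T.2.mem_of_bullet_mem (φ := φ)
    have hN := T.2.bullet_mem_of_nabla_mem (φ := φ)
    tauto

theorem propN_canonicalModel (hAx : ENAx ⊆ Ax)
    (hne : Nonempty {T // IsMaxConsistent Ax T}) : (canonicalModel Ax hne).PropN := by
  intro (T : {T // IsMaxConsistent Ax T})
  have htop (U : {T // IsMaxConsistent Ax T}) : top ∈ U.1 := U.2.imp_mem_iff.2 id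
  have huniv : proofSet Ax top = Set.univ := Set.eq_univ_of_forall htop
  have hB : top.bullet ∉ T.1 := T.2.neg_mem_iff.1 (T.2.mem_of_prf (.ax (hAx rfl)))
  change Set.univ ∈ canonicalNbhds T
  rw [← huniv, proofSet_mem_canonicalNbhds]
  exact ⟨fun h => hB (T.2.bullet_mem_of_nabla_mem h (htop T)), hB⟩

end

/-- EN^{∇•} is sound and strongly complete with respect to the
class of (n)-frames. -/
theorem EN_sound_and_strongly_complete (Γ : Set Formula) (φ : Formula) :
    Deriv ENAx Γ φ ↔
      ∀ (M : NbhdModel), M.PropN →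
        ∀ s : M.S, (∀ γ ∈ Γ, M.Sat s γ) → M.Sat s φ := by
  refine ⟨fun h M hM s hs => NbhdModel.sat_of_deriv hM.sat_ENAx h hs, fun h => ?_⟩
  by_contra hd
  obtain ⟨T, hT, hΓT, hφ⟩ := exists_isMaxConsistent_of_not_deriv hd
  have hne : Nonempty {T // IsMaxConsistent ENAx T} := ⟨⟨T, hT⟩⟩
  have hsat (ψ : Formula) : (canonicalModel ENAx hne).Sat ⟨T, hT⟩ ψ ↔ ψ ∈ T :=
    Set.ext_iff.1 (truthSet_canonicalModel hne ψ) ⟨T, hT⟩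
  exact hφ <| (hsat φ).1 <| h _ (propN_canonicalModel subset_rfl hne) _
    fun γ hγ => (hsat γ).2 (hΓT hγ)
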